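/- Let d, σ > 0 and let I = [α, β] ⊂ ℝ be a closed interval with β − α ≥ d. Let u, v : I → ℝ² be such that Var(u, I) ≤ σ/4 and Var(v, I) ≤ σ/3, the function x ↦ ‖u(x) − v(x)‖ is Lebesgue measurable on I, and ∫_I ‖u(x) − v(x)‖ dx < d·σ/4. Then sup_{x ∈ I} ‖u(x) − v(x)‖ ≤ σ/4 + σ/4 + σ/3 < σ. -/

import Mathlib

open Set Filter MeasureTheory

/-- `L¹`-closeness of two maps of small variation on an interval of
length at least `d` upgrades to uniform closeness. -/
theorem stmt_8 (d σ α β : ℝ) (hd : 0 < d) (hσ : 0 < σ) (hlen : d ≤ β - α)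
    (u v : ℝ → EuclideanSpace ℝ (Fin 2))
    (hu : eVariationOn u (Set.Icc α β) ≤ ENNReal.ofReal (σ / 4))
    (hv : eVariationOn v (Set.Icc α β) ≤ ENNReal.ofReal (σ / 3))
    (hmeas : AEMeasurable (fun x => ‖u x - v x‖) (volume.restrict (Set.Icc α β)))
    (hint : ∫ x in Set.Icc α β, ‖u x - v x‖ < d * σ / 4) :
    (∀ x ∈ Set.Icc α β, ‖u x - v x‖ ≤ σ / 4 + σ / 4 + σ / 3) ∧
      σ / 4 + σ / 4 + σ / 3 < σ := by
  have key : ∀ (w : ℝ → EuclideanSpace ℝ (Fin 2)) (c : ℝ), 0 < c →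
      eVariationOn w (Set.Icc α β) ≤ ENNReal.ofReal c →
      ∀ x ∈ Set.Icc α β, ∀ y ∈ Set.Icc α β, ‖w x - w y‖ ≤ c := by
    intro w c hc hw x hx y hy
    have h := (eVariationOn.edist_le w hx hy).trans hw
    rw [edist_dist, ENNReal.ofReal_le_ofReal_iff hc.le, dist_eq_norm] at h
    exact h
  have ku := key u (σ / 4) (by positivity) hu
  have kv := key v (σ / 3) (by positivity) hv
  have tri : ∀ x ∈ Set.Icc α β, ∀ y ∈ Set.Icc α β,
      ‖u x - v x‖ ≤ ‖u y - v y‖ + σ / 4 + σ / 3 := by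
    intro x hx y hy
    have e : u x - v x = (u y - v y) + (u x - u y) + (v y - v x) := by abel
    rw [e]
    have h1 := norm_add₃_le (a := u y - v y) (b := u x - u y) (c := v y - v x)
    linarith [ku x hx y hy, kv y hy x hx]
  refine ⟨?_, by linarith⟩
  have hα : α ∈ Set.Icc α β := ⟨le_rfl, by linarith⟩
  have hI : IntegrableOn (fun x => ‖u x - v x‖) (Set.Icc α β) := by
    refine Integrable.of_bound (μ := volume.restrict (Set.Icc α β))
      hmeas.aestronglyMeasurable (‖u α - v α‖ + σ / 4 + σ / 3) ?_
    refine (ae_restrict_iff' measurableSet_Icc).2 (Eventually.of_forall ?_)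
    intro x hx
    rw [norm_norm]
    exact tri x hx α hα
  obtain ⟨y, hy, hyl⟩ : ∃ y ∈ Set.Icc α β, ‖u y - v y‖ ≤ σ / 4 := by
    by_contra! hcon
    have h := setIntegral_mono_on (μ := volume) (f := fun _ : ℝ => σ / 4)
      (integrableOn_const (by simp)) hI
      measurableSet_Icc (fun x hx => (hcon x hx).le)
    rw [setIntegral_const, Real.volume_real_Icc_of_le (by linarith), smul_eq_mul] at h
    nlinarith
  intro x hx
  linarith [tri x hx y hy]
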